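/- Let A, B be real matrices of sizes n×n and n×m, C, D real matrices of sizes p×n and p×m, α ∈ ℝ, Q a symmetric p×p real matrix, S a p×m real matrix, R a symmetric m×m real matrix, and P a diagonal positive definite n×n real matrix such that the block matrix [[CᵀQC − 2AᵀPA + P − 2α²P, CᵀQD + CᵀS − 2AᵀPB], [DᵀQC + SᵀC − 2BᵀPA, DᵀQD + SᵀD + DᵀS + R − 2BᵀPB]] is positive semidefinite. Consider the nonlinear discrete-time system x_{k+1} = A x_k + α sin(x_k) + B u_k, y_k = C x_k + D u_k, where sin is applied entrywise to the vector x_k. Then for every input sequence u : ℕ → ℝ^m, every state trajectory x : ℕ → ℝ^n of this system, and every T ∈ ℕ, Σ_{k=0}^{T} ( y_kᵀ Q y_k + 2 y_kᵀ S u_k + u_kᵀ R u_k ) ≥ −x₀ᵀ P x₀. -/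

import Mathlib

open Matrix

theorem Matrix.IsSymm.dotProduct_mulVec_comm {ι : Type*} [Fintype ι]
    {M : Matrix ι ι ℝ} (hM : M.IsSymm) (v w : ι → ℝ) :
    v ⬝ᵥ M *ᵥ w = w ⬝ᵥ M *ᵥ v := by
  rw [dotProduct_mulVec, ← mulVec_transpose, hM.eq, dotProduct_comm]

theorem Matrix.dotProduct_transpose_mulVec_eq {ι κ : Type*} [Fintype ι] [Fintype κ]
    (M : Matrix κ ι ℝ) (v : ι → ℝ) (w : κ → ℝ) :
    v ⬝ᵥ Mᵀ *ᵥ w = M *ᵥ v ⬝ᵥ w := by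
  rw [dotProduct_mulVec, vecMul_transpose]

theorem Matrix.PosSemidef.dotProduct_mulVec_add_le {ι : Type*} [Fintype ι]
    {P : Matrix ι ι ℝ} (hP : P.PosSemidef) (v s : ι → ℝ) :
    (v + s) ⬝ᵥ P *ᵥ (v + s) ≤ 2 * (v ⬝ᵥ P *ᵥ v) + 2 * (s ⬝ᵥ P *ᵥ s) := by
  have h := hP.dotProduct_mulVec_nonneg (v - s)
  simp only [star_trivial, mulVec_sub, sub_dotProduct, dotProduct_sub] at h
  simp only [mulVec_add, add_dotProduct, dotProduct_add]
  linarith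

theorem Matrix.IsDiag.dotProduct_mulVec_sin_le {ι : Type*} [Fintype ι] [DecidableEq ι]
    {P : Matrix ι ι ℝ} (hdiag : P.IsDiag) (hP : P.PosSemidef) (x : ι → ℝ) :
    (fun i => Real.sin (x i)) ⬝ᵥ P *ᵥ (fun i => Real.sin (x i)) ≤ x ⬝ᵥ P *ᵥ x := by
  have hnonneg : ∀ i, 0 ≤ P i i := fun i => hP.diag_nonneg
  rw [← hdiag.diagonal_diag]
  simp only [dotProduct, mulVec_diagonal, diag_apply]
  refine Finset.sum_le_sum fun i _ => ?_
  have hsq : Real.sin (x i) ^ 2 ≤ x i ^ 2 := sq_le_sq.mpr Real.abs_sin_le_abs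
  nlinarith [mul_le_mul_of_nonneg_left hsq (hnonneg i)]

/-- QSR-dissipativity of the nonlinear plant
`x_{k+1} = A x_k + α sin(x_k) + B u_k`, `y_k = C x_k + D u_k` (Lemma 8):
feasibility of the displayed matrix inequality (with diagonal `P ≻ 0`)
implies the QSR dissipation inequality along every trajectory. -/
theorem nonlinear_plant_qsr_dissipative {n m p : ℕ}
    (A : Matrix (Fin n) (Fin n) ℝ) (B : Matrix (Fin n) (Fin m) ℝ)
    (C : Matrix (Fin p) (Fin n) ℝ) (D : Matrix (Fin p) (Fin m) ℝ)
    (α : ℝ)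
    (Q : Matrix (Fin p) (Fin p) ℝ) (S : Matrix (Fin p) (Fin m) ℝ)
    (R : Matrix (Fin m) (Fin m) ℝ)
    (hQ : Q.IsSymm) (hR : R.IsSymm)
    (P : Matrix (Fin n) (Fin n) ℝ) (hP : P.PosDef) (hPdiag : P.IsDiag)
    (hLMI : (Matrix.fromBlocks
        (Cᵀ * Q * C - (2 : ℝ) • (Aᵀ * P * A) + P - (2 * α ^ 2) • P)
        (Cᵀ * Q * D + Cᵀ * S - (2 : ℝ) • (Aᵀ * P * B))
        (Dᵀ * Q * C + Sᵀ * C - (2 : ℝ) • (Bᵀ * P * A))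
        (Dᵀ * Q * D + Sᵀ * D + Dᵀ * S + R - (2 : ℝ) • (Bᵀ * P * B))).PosSemidef)
    (u : ℕ → Fin m → ℝ) (x : ℕ → Fin n → ℝ) (y : ℕ → Fin p → ℝ)
    (hx : ∀ k, x (k + 1) =
      A *ᵥ x k + α • (fun i => Real.sin (x k i)) + B *ᵥ u k)
    (hy : ∀ k, y k = C *ᵥ x k + D *ᵥ u k) (T : ℕ) :
    ∑ k ∈ Finset.range (T + 1),
        (y k ⬝ᵥ Q *ᵥ y k + 2 * (y k ⬝ᵥ S *ᵥ u k) + u k ⬝ᵥ R *ᵥ u k) ≥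
      -(x 0 ⬝ᵥ P *ᵥ x 0) := by
  have hPsymm : P.IsSymm := by simpa [IsHermitian, IsSymm] using hP.isHermitian
  have hstep : ∀ k, x (k + 1) ⬝ᵥ P *ᵥ x (k + 1) - x k ⬝ᵥ P *ᵥ x k ≤
      y k ⬝ᵥ Q *ᵥ y k + 2 * (y k ⬝ᵥ S *ᵥ u k) + u k ⬝ᵥ R *ᵥ u k := by
    intro k
    have hL := hLMI.dotProduct_mulVec_nonneg (Sum.elim (x k) (u k))
    have hsin := mul_le_mul_of_nonneg_left
      (hPdiag.dotProduct_mulVec_sin_le hP.posSemidef (x k)) (sq_nonneg α)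
    have hadd := hP.posSemidef.dotProduct_mulVec_add_le
      (A *ᵥ x k + B *ᵥ u k) (α • (fun i => Real.sin (x k i)))
    rw [hx k, hy k, add_right_comm]
    simp only [star_trivial, fromBlocks_mulVec, Sum.elim_comp_inl, Sum.elim_comp_inr,
      sumElim_dotProduct_sumElim,
      add_mulVec, sub_mulVec, smul_mulVec, ← mulVec_mulVec, dotProduct_add, dotProduct_sub,
      dotProduct_smul, smul_eq_mul, dotProduct_transpose_mulVec_eq] at hL
    simp only [mulVec_add, mulVec_smul, add_dotProduct, dotProduct_add, smul_dotProduct,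
      dotProduct_smul, smul_eq_mul] at hadd ⊢
    have hQcross := hQ.dotProduct_mulVec_comm (C *ᵥ x k) (D *ᵥ u k)
    have hPcross := hPsymm.dotProduct_mulVec_comm (A *ᵥ x k) (B *ᵥ u k)
    have hScross₁ := dotProduct_comm (S *ᵥ u k) (C *ᵥ x k)
    have hScross₂ := dotProduct_comm (S *ᵥ u k) (D *ᵥ u k)
    linarith
  have hsum := Finset.sum_le_sum fun k (_ : k ∈ Finset.range (T + 1)) => hstep k
  rw [Finset.sum_range_sub fun k => x k ⬝ᵥ P *ᵥ x k] at hsum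
  have hfinal := hP.posSemidef.dotProduct_mulVec_nonneg (x (T + 1))
  rw [star_trivial] at hfinal
  linarith
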